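/- Let D be a quaternion division algebra over a field L of characteristic ≠ 2 with standard involution τ₀. The assignment h ↦ q_h (trace form) induces an injective group homomorphism W(D, τ₀) → W(L), whose image is the principal ideal of W(L) generated by the norm form n_D of D. In particular, two hermitian forms over (D, τ₀) are isomorphic if and only if their trace forms are isomorphic as quadratic forms. -/

import Mathlib

open scoped Quaternion

section Defs

variable (F : Type*) [Field F]

/-- Isometry of two "quadratic forms", given as plain functions on `F`-vector
spaces: a linear equivalence matching the values. -/
def QFunEquiv {V₁ V₂ : Type*} [AddCommGroup V₁] [Module F V₁]
    [AddCommGroup V₂] [Module F V₂] (q₁ : V₁ → F) (q₂ : V₂ → F) : Prop :=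
  ∃ g : V₁ ≃ₗ[F] V₂, ∀ x, q₂ (g x) = q₁ x

/-- The diagonal quadratic form `⟨c i⟩ᵢ`. -/
def diagQ {ι : Type*} [Fintype ι] (c : ι → F) : (ι → F) → F :=
  fun x => ∑ i, c i * x i ^ 2

/-- Diagonal coefficients `⟨1, -1, 1, -1, …⟩` of a sum of `k` hyperbolic planes. -/
def hypDiag (k : ℕ) : Fin (2 * k) → F :=
  fun j => if (j : ℕ) % 2 = 0 then 1 else -1

/-- Orthogonal sum of two quadratic forms. -/
def qSum {V₁ V₂ : Type*} (q₁ : V₁ → F) (q₂ : V₂ → F) : V₁ × V₂ → F :=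
  fun p => q₁ p.1 + q₂ p.2

/-- Witt equivalence of quadratic forms: isometry after adding hyperbolic planes. -/
def WittEquivQ {V₁ V₂ : Type*} [AddCommGroup V₁] [Module F V₁]
    [AddCommGroup V₂] [Module F V₂] (q₁ : V₁ → F) (q₂ : V₂ → F) : Prop :=
  ∃ k m : ℕ, QFunEquiv F (qSum F q₁ (diagQ F (hypDiag F k)))
    (qSum F q₂ (diagQ F (hypDiag F m)))

variable (a b : F)

/-- The diagonal hermitian form `⟨λᵢ⟩ᵢ` over the quaternion algebra
`D = ℍ[F, a, b]` with its standard (symplectic) involution `τ₀ = star`: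
`h(x, y) = ∑ᵢ τ₀(xᵢ) λᵢ yᵢ`. -/
def hermD {ι : Type*} [Fintype ι] (lam : ι → F)
    (x y : ι → ℍ[F, a, b]) : ℍ[F, a, b] :=
  ∑ i, star (x i) * algebraMap F ℍ[F, a, b] (lam i) * y i

/-- Isometry of diagonal hermitian forms over `(D, τ₀)`: an `F`-linear
equivalence which is right `D`-linear and matches the forms. -/
def HermIso {ι₁ ι₂ : Type*} [Fintype ι₁] [Fintype ι₂]
    (lam : ι₁ → F) (mu : ι₂ → F) : Prop :=
  ∃ g : (ι₁ → ℍ[F, a, b]) ≃ₗ[F] (ι₂ → ℍ[F, a, b]),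
    (∀ (x : ι₁ → ℍ[F, a, b]) (d : ℍ[F, a, b]),
      g (fun i => x i * d) = fun i => g x i * d) ∧
    (∀ x y, hermD F a b mu (g x) (g y) = hermD F a b lam x y)

/-- Witt equivalence of diagonal hermitian forms over `(D, τ₀)`. -/
def HermWittEquiv {ι₁ ι₂ : Type*} [Fintype ι₁] [Fintype ι₂]
    (lam : ι₁ → F) (mu : ι₂ → F) : Prop :=
  ∃ k m : ℕ, HermIso F a b (Sum.elim lam (hypDiag F k)) (Sum.elim mu (hypDiag F m))

/-- The trace form `q_h(x) = h(x, x)` of the diagonal hermitian form `⟨λᵢ⟩ᵢ`,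
a quadratic form over `F` (the value `h(x,x)` is a scalar, and we record its
scalar part). -/
def traceQ {ι : Type*} [Fintype ι] (lam : ι → F) (x : ι → ℍ[F, a, b]) : F :=
  (hermD F a b lam x x).re

end Defs

namespace QFunEquiv

variable {F : Type*} [Field F] {V₁ V₂ V₃ V₄ : Type*}
  [AddCommGroup V₁] [Module F V₁] [AddCommGroup V₂] [Module F V₂]
  [AddCommGroup V₃] [Module F V₃] [AddCommGroup V₄] [Module F V₄]
  {q₁ : V₁ → F} {q₂ : V₂ → F} {q₃ : V₃ → F} {q₄ : V₄ → F}

theorem refl (q : V₁ → F) : QFunEquiv F q q := ⟨.refl F V₁, fun _ => rfl⟩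

theorem symm (h : QFunEquiv F q₁ q₂) : QFunEquiv F q₂ q₁ := by
  obtain ⟨g, hg⟩ := h
  exact ⟨g.symm, fun x => by rw [← hg, g.apply_symm_apply]⟩

theorem trans (h : QFunEquiv F q₁ q₂) (h' : QFunEquiv F q₂ q₃) : QFunEquiv F q₁ q₃ := by
  obtain ⟨g, hg⟩ := h
  obtain ⟨g', hg'⟩ := h'
  exact ⟨g.trans g', fun x => by rw [LinearEquiv.trans_apply, hg', hg]⟩

theorem qSum (h : QFunEquiv F q₁ q₂) (h' : QFunEquiv F q₃ q₄) :
    QFunEquiv F (qSum F q₁ q₃) (qSum F q₂ q₄) := by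
  obtain ⟨g, hg⟩ := h
  obtain ⟨g', hg'⟩ := h'
  exact ⟨g.prodCongr g', fun x => by simp [_root_.qSum, hg, hg']⟩

end QFunEquiv

section Cancellation

variable {F : Type*} [Field F] {V V₁ V₂ : Type*}
  [AddCommGroup V] [Module F V] [AddCommGroup V₁] [Module F V₁] [AddCommGroup V₂] [Module F V₂]

open QuadraticMap

/-- The reflection along an anisotropic vector `w` is an isometry. -/
theorem QuadraticForm.exists_reflection (Q : QuadraticForm F V) {w : V} (hw : Q w ≠ 0) :
    ∃ s : V ≃ₗ[F] V, (∀ x, Q (s x) = Q x) ∧ ∀ x, s x = x - (polar Q w x / Q w) • w := by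
  have h2 : ((Q w)⁻¹ • Q.polarBilin w) w = 2 := by
    simp only [LinearMap.smul_apply, polarBilin_apply_apply, polar_self, smul_eq_mul, nsmul_eq_mul,
      Nat.cast_ofNat]
    field_simp
  have hs (x : V) : Module.reflection h2 x = x - (polar Q w x / Q w) • w := by
    simp [Module.reflection_apply, div_eq_inv_mul]
  refine ⟨Module.reflection h2, fun x => ?_, hs⟩
  have key := QuadraticMap.map_add Q x (-(polar Q w x / Q w) • w)
  rw [QuadraticMap.map_smul, polar_smul_right, polar_comm Q x w] at key
  rw [hs, sub_eq_add_neg, ← neg_smul, key]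
  simp only [smul_eq_mul]
  field_simp
  ring

theorem QuadraticForm.exists_isometry_map_eq (h2 : (2 : F) ≠ 0) (Q : QuadraticForm F V) {u v : V}
    (huv : Q u = Q v) (hv : Q v ≠ 0) :
    ∃ s : V ≃ₗ[F] V, (∀ x, Q (s x) = Q x) ∧ s u = v := by
  have hadd := QuadraticMap.map_add Q u v
  have hsub := QuadraticMap.map_add Q u (-v)
  rw [polar_neg_right, QuadraticMap.map_neg] at hsub
  rw [← sub_eq_add_neg] at hsub
  by_cases h : Q (u - v) = 0
  · have hne : Q (u + v) ≠ 0 := fun h' => by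
      have : (2 * 2) * Q v = 0 := by linear_combination h + h' - hsub - hadd - 2 * huv
      exact hv ((mul_eq_zero.mp this).resolve_left (mul_ne_zero h2 h2))
    obtain ⟨s, hs, hs'⟩ := Q.exists_reflection hne
    refine ⟨s.trans (LinearEquiv.neg F), fun x => by simp [hs], ?_⟩
    have : polar Q (u + v) u = Q (u + v) := by
      rw [polar_add_left, polar_self, polar_comm Q v u, nsmul_eq_mul, Nat.cast_ofNat]
      linear_combination -hadd + huv
    simp [hs', this, div_self hne]
  · obtain ⟨s, hs, hs'⟩ := Q.exists_reflection h
    refine ⟨s, hs, ?_⟩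
    have : polar Q (u - v) u = Q (u - v) := by
      rw [polar_sub_left, polar_self, polar_comm Q v u, nsmul_eq_mul, Nat.cast_ofNat]
      linear_combination -hsub + huv
    simp [hs', this, div_self h]

/-- **Witt cancellation** of a one-dimensional nonsingular form. -/
theorem QFunEquiv.of_qSum_line (h2 : (2 : F) ≠ 0) {c : F} (hc : c ≠ 0)
    (Q₁ : QuadraticForm F V₁) (Q₂ : QuadraticForm F V₂)
    (h : QFunEquiv F (_root_.qSum F Q₁ fun t : F => c * t ^ 2)
      (_root_.qSum F Q₂ fun t : F => c * t ^ 2)) :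
    QFunEquiv F Q₁ Q₂ := by
  obtain ⟨g, hg⟩ := h
  set P₁ : QuadraticForm F (V₁ × F) := Q₁.prod (c • QuadraticMap.sq) with hP₁
  set P₂ : QuadraticForm F (V₂ × F) := Q₂.prod (c • QuadraticMap.sq) with hP₂
  have e₁ (x) : P₁ x = Q₁ x.1 + c * x.2 ^ 2 := by simp [hP₁, pow_two]
  have e₂ (x) : P₂ x = Q₂ x.1 + c * x.2 ^ 2 := by simp [hP₂, pow_two]
  have hg' (x) : P₂ (g x) = P₁ x := by rw [e₁, e₂]; exact hg x
  obtain ⟨s, hs, hs'⟩ := P₂.exists_isometry_map_eq h2 (u := g (0, 1)) (v := (0, 1))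
    (by rw [hg']; simp [e₁, e₂]) (by simpa [e₂] using hc)
  set e := g.trans s
  have he (x) : P₂ (e x) = P₁ x := by simp [e, hs, hg']
  have he1 : e (0, 1) = (0, 1) := hs'
  have perp (x : V₁) : (e (x, 0)).2 = 0 := by
    have h₁ := he ((x, 0) + (0, 1))
    have h₂ := he (x, 0)
    rw [map_add, he1] at h₁
    simp only [e₁, e₂, Prod.fst_add, Prod.snd_add, add_zero] at h₁ h₂
    have : 2 * c * (e (x, 0)).2 = 0 := by linear_combination h₁ - h₂
    simpa [h2, hc] using this
  have he1' : e.symm (0, 1) = (0, 1) := by rw [e.symm_apply_eq, he1]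
  have he' (x) : P₁ (e.symm x) = P₂ x := by rw [← he, e.apply_symm_apply]
  have perp' (x : V₂) : (e.symm (x, 0)).2 = 0 := by
    have h₁ := he' ((x, 0) + (0, 1))
    have h₂ := he' (x, 0)
    rw [map_add, he1'] at h₁
    simp only [e₁, e₂, Prod.fst_add, Prod.snd_add, add_zero] at h₁ h₂
    have : 2 * c * (e.symm (x, 0)).2 = 0 := by linear_combination h₁ - h₂
    simpa [h2, hc] using this
  refine ⟨LinearEquiv.ofLinearMap
    (LinearMap.fst F V₂ F ∘ₗ e.toLinearMap ∘ₗ LinearMap.inl F V₁ F)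
    (LinearMap.fst F V₁ F ∘ₗ e.symm.toLinearMap ∘ₗ LinearMap.inl F V₂ F) ?_ ?_, fun x => ?_⟩
  · ext x
    have : ((e.symm (x, 0)).1, (0 : F)) = e.symm (x, 0) := Prod.ext rfl (perp' x).symm
    simp [this]
  · ext x
    have : ((e (x, 0)).1, (0 : F)) = e (x, 0) := Prod.ext rfl (perp x).symm
    simp [this]
  · have := he (x, 0)
    simp only [e₁, e₂, perp] at this
    simpa using this

end Cancellation

section Diagonal

variable {F : Type*} [Field F] {ι κ ν : Type} [Fintype ι] [Fintype κ] [Fintype ν]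

theorem diagQ_reindex {c : ι → F} {d : κ → F} (e : ι ≃ κ) (h : ∀ i, d (e i) = c i) :
    QFunEquiv F (diagQ F c) (diagQ F d) := by
  refine ⟨LinearEquiv.funCongrLeft F F e.symm, fun x => ?_⟩
  simp only [diagQ, LinearEquiv.funCongrLeft_apply, LinearMap.funLeft_apply]
  exact Fintype.sum_equiv e.symm _ _ fun i => by rw [← h, e.apply_symm_apply]

theorem diagQ_sumElim (c : ι → F) (d : κ → F) :
    QFunEquiv F (diagQ F (Sum.elim c d)) (qSum F (diagQ F c) (diagQ F d)) :=
  ⟨LinearEquiv.sumArrowLequivProdArrow ι κ F F, fun x => by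
    simp [diagQ, qSum]⟩

theorem card_eq_of_diagQ {c : ι → F} {d : κ → F} (h : QFunEquiv F (diagQ F c) (diagQ F d)) :
    Fintype.card ι = Fintype.card κ := by
  obtain ⟨g, -⟩ := h
  simpa using g.finrank_eq

theorem coe_weightedSumSquares (c : ι → F) :
    ⇑(QuadraticMap.weightedSumSquares F c) = diagQ F c := by
  ext x
  simp [diagQ, QuadraticMap.weightedSumSquares_apply, pow_two]

theorem QFunEquiv.diagQ_cancel_fin (h2 : (2 : F) ≠ 0) {c : ι → F} {d : κ → F} {n : ℕ}
    {e : Fin n → F}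
    (he : ∀ i, e i ≠ 0)
    (h : QFunEquiv F (diagQ F (Sum.elim c e)) (diagQ F (Sum.elim d e))) :
    QFunEquiv F (diagQ F c) (diagQ F d) := by
  induction n with
  | zero =>
    exact (diagQ_reindex (Equiv.sumEmpty ι (Fin 0)).symm fun _ => rfl).trans
      (h.trans (diagQ_reindex (Equiv.sumEmpty κ (Fin 0)) (by
        rintro (i | i)
        · rfl
        · exact i.elim0)))
  | succ n ih =>
    have key {μ : Type} [Fintype μ] (c : μ → F) :
        QFunEquiv F (diagQ F (Sum.elim c e))
          (_root_.qSum F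
            (QuadraticMap.weightedSumSquares F (Sum.elim c fun i : Fin n => e i.castSucc))
            (fun t : F => e (Fin.last n) * t ^ 2)) := by
      have h₁ : QFunEquiv F (diagQ F (Sum.elim c e))
          (diagQ F (Sum.elim (Sum.elim c fun i : Fin n => e i.castSucc)
            (fun _ : Fin 1 => e (Fin.last n)))) :=
        (diagQ_reindex ((Equiv.sumAssoc μ (Fin n) (Fin 1)).trans
          (Equiv.sumCongr (.refl μ) finSumFinEquiv)) (by
            rintro ((i | i) | i)
            · rfl
            · rfl
            · obtain rfl := Subsingleton.elim i 0; rfl)).symm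
      refine h₁.trans ((diagQ_sumElim _ _).trans (QFunEquiv.qSum ?_
        ⟨LinearEquiv.funUnique (Fin 1) F F, fun x => ?_⟩))
      · rw [coe_weightedSumSquares]
        exact QFunEquiv.refl _
      · simp [diagQ]
    refine ih (fun i => he i.castSucc) ?_
    have := QFunEquiv.of_qSum_line h2 (he (Fin.last n)) _ _ ((key c).symm.trans (h.trans (key d)))
    rwa [coe_weightedSumSquares, coe_weightedSumSquares] at this

/-- **Witt cancellation** for diagonal forms. -/
theorem QFunEquiv.diagQ_cancel (h2 : (2 : F) ≠ 0) {c : ι → F} {d : κ → F} {e : ν → F}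
    (he : ∀ i, e i ≠ 0)
    (h : QFunEquiv F (diagQ F (Sum.elim c e)) (diagQ F (Sum.elim d e))) :
    QFunEquiv F (diagQ F c) (diagQ F d) := by
  let f := (Fintype.equivFin ν).symm
  have key {μ : Type} [Fintype μ] (c : μ → F) :
      QFunEquiv F (diagQ F (Sum.elim c (e ∘ f))) (diagQ F (Sum.elim c e)) :=
    diagQ_reindex (Equiv.sumCongr (.refl μ) f) (by rintro (i | i) <;> rfl)
  exact diagQ_cancel_fin h2 (e := e ∘ f) (fun i => he _) ((key c).trans (h.trans (key d).symm))

theorem diagQ_sumElim_congr {ι' κ' : Type} [Fintype ι'] [Fintype κ'] {c : ι → F} {d : κ → F}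
    {c' : ι' → F} {d' : κ' → F} (h : QFunEquiv F (diagQ F c) (diagQ F c'))
    (h' : QFunEquiv F (diagQ F d) (diagQ F d')) :
    QFunEquiv F (diagQ F (Sum.elim c d)) (diagQ F (Sum.elim c' d')) :=
  (diagQ_sumElim c d).trans ((h.qSum h').trans (diagQ_sumElim c' d').symm)

/-- `⟨c⟩ ⊥ ⟨-c⟩` is hyperbolic. -/
theorem diagQ_sumElim_neg (h2 : (2 : F) ≠ 0) {c : ι → F} (hc : ∀ i, c i ≠ 0) :
    QFunEquiv F (diagQ F (Sum.elim c (-c)))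
      (diagQ F (Sum.elim (fun _ : ι => (1 : F)) (fun _ : ι => -1))) := by
  suffices h : ∀ c : ι → F, (∀ i, c i ≠ 0) → QFunEquiv F (diagQ F (Sum.elim c (-c)))
      (fun p : (ι → F) × (ι → F) => ∑ i, p.1 i * p.2 i) from
    (h c hc).trans (h 1 fun _ => one_ne_zero).symm
  intro c hc
  refine ⟨(LinearEquiv.sumArrowLequivProdArrow ι ι F F).trans
    { toFun := fun p => (fun i => c i * (p.1 i - p.2 i), fun i => p.1 i + p.2 i)
      invFun := fun p => (fun i => (p.2 i + p.1 i / c i) / 2, fun i => (p.2 i - p.1 i / c i) / 2)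
      map_add' := fun p q => by ext i <;> simp <;> ring
      map_smul' := fun t p => by ext i <;> simp <;> ring
      left_inv := fun p => by ext i <;> simp only <;> field [hc i]
      right_inv := fun p => by ext i <;> simp only <;> field [hc i] }, fun x => ?_⟩
  simp only [diagQ, Fintype.sum_sum_type, ← Finset.sum_add_distrib]
  refine Finset.sum_congr rfl fun i _ => ?_
  simp
  ring

theorem hypDiag_ne_zero (k : ℕ) (j : Fin (2 * k)) : hypDiag F k j ≠ 0 := by
  unfold hypDiag
  split_ifs <;> simp

theorem diagQ_hypDiag (k : ℕ) :
    QFunEquiv F (diagQ F (Sum.elim (fun _ : Fin k => (1 : F)) (fun _ : Fin k => -1)))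
      (diagQ F (hypDiag F k)) := by
  refine diagQ_reindex ((Equiv.boolProdEquivSum (Fin k)).symm.trans ((Equiv.prodComm _ _).trans
    ((Equiv.prodCongr (.refl _) finTwoEquiv.symm).trans
      (finProdFinEquiv.trans (finCongr (mul_comm k 2)))))) ?_
  rintro (i | i) <;> simp [hypDiag, finProdFinEquiv, finTwoEquiv]

theorem diagQ_sumElim_neg_hypDiag (h2 : (2 : F) ≠ 0) {c : ι → F} (hc : ∀ i, c i ≠ 0) {k : ℕ}
    (hk : Fintype.card ι = k) :
    QFunEquiv F (diagQ F (Sum.elim c (-c))) (diagQ F (hypDiag F k)) := by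
  let e := Fintype.equivFinOfCardEq hk
  exact (diagQ_sumElim_neg h2 hc).trans ((diagQ_reindex (Equiv.sumCongr e e) (by
    rintro (i | i) <;> rfl)).trans (diagQ_hypDiag k))

theorem diagQ_hypDiag_add (k m : ℕ) :
    QFunEquiv F (diagQ F (Sum.elim (hypDiag F k) (hypDiag F m))) (diagQ F (hypDiag F (k + m))) := by
  refine diagQ_reindex (finSumFinEquiv.trans (finCongr (mul_add 2 k m).symm)) ?_
  rintro (i | i) <;> simp [hypDiag, Nat.add_mod]

end Diagonal

namespace HermIso

variable {F : Type*} [Field F] {a b : F} {ι κ ν μ : Type}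
  [Fintype ι] [Fintype κ] [Fintype ν] [Fintype μ]
  {c : ι → F} {d : κ → F} {e : ν → F} {f : μ → F}

theorem refl (c : ι → F) : HermIso F a b c c :=
  ⟨.refl F _, fun _ _ => rfl, fun _ _ => rfl⟩

theorem symm (h : HermIso F a b c d) : HermIso F a b d c := by
  obtain ⟨g, hg, hg'⟩ := h
  refine ⟨g.symm, fun x q => ?_, fun x y => ?_⟩
  · rw [g.symm_apply_eq, hg, g.apply_symm_apply]
  · rw [← hg', g.apply_symm_apply, g.apply_symm_apply]

theorem trans (h : HermIso F a b c d) (h' : HermIso F a b d e) : HermIso F a b c e := by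
  obtain ⟨g, hg, hg'⟩ := h
  obtain ⟨k, hk, hk'⟩ := h'
  exact ⟨g.trans k, fun x q => by simp only [LinearEquiv.trans_apply, hg, hk],
    fun x y => by simp only [LinearEquiv.trans_apply, hg', hk']⟩

theorem reindex (s : ι ≃ κ) (h : ∀ i, d (s i) = c i) : HermIso F a b c d := by
  refine ⟨LinearEquiv.funCongrLeft F ℍ[F, a, b] s.symm, fun _ _ => rfl, fun x y => ?_⟩
  simp only [hermD, LinearEquiv.funCongrLeft_apply, LinearMap.funLeft_apply]
  exact Fintype.sum_equiv s.symm _ _ fun i => by rw [← h, s.apply_symm_apply]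

theorem sumElim (h : HermIso F a b c d) (h' : HermIso F a b e f) :
    HermIso F a b (Sum.elim c e) (Sum.elim d f) := by
  obtain ⟨g, hg, hg'⟩ := h
  obtain ⟨k, hk, hk'⟩ := h'
  refine ⟨(LinearEquiv.sumArrowLequivProdArrow ι ν F _).trans ((g.prodCongr k).trans
    (LinearEquiv.sumArrowLequivProdArrow κ μ F _).symm), fun x q => ?_, fun x y => ?_⟩
  · ext1 (i | i)
    · exact congrFun (hg (fun i => x (.inl i)) q) i
    · exact congrFun (hk (fun i => x (.inr i)) q) i
  · have h₁ := hg' (fun i => x (.inl i)) (fun i => y (.inl i))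
    have h₂ := hk' (fun i => x (.inr i)) (fun i => y (.inr i))
    simp only [hermD, Fintype.sum_sum_type] at h₁ h₂ ⊢
    exact congrArg₂ (· + ·) h₁ h₂

theorem sumAssoc (c : ι → F) (d : κ → F) (e : ν → F) :
    HermIso F a b (Sum.elim (Sum.elim c d) e) (Sum.elim c (Sum.elim d e)) :=
  reindex (Equiv.sumAssoc ι κ ν) (by rintro ((i | i) | i) <;> rfl)

theorem sumComm (c : ι → F) (d : κ → F) :
    HermIso F a b (Sum.elim c d) (Sum.elim d c) :=
  reindex (Equiv.sumComm ι κ) (by rintro (i | i) <;> rfl)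

/-- Rescaling a one-dimensional form by a norm. -/
theorem line_of_norm (l : F) {q : ℍ[F, a, b]} (hq : IsUnit q) :
    HermIso F a b (fun _ : Fin 1 => l * (star q * q).re) (fun _ : Fin 1 => l) := by
  obtain ⟨q, rfl⟩ := hq
  refine ⟨{ toFun := fun x i => q * x i
            invFun := fun x i => ↑q⁻¹ * x i
            map_add' := fun x y => by ext1 i; simp [mul_add]
            map_smul' := fun t x => by ext1 i; simp
            left_inv := fun x => by ext1 i; simp
            right_inv := fun x => by ext1 i; simp }, fun x d => ?_, fun x y => ?_⟩
  · ext1 i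
    simp [mul_assoc]
  · simp only [hermD, LinearEquiv.coe_mk, LinearMap.coe_mk, AddHom.coe_mk, star_mul]
    refine Finset.sum_congr rfl fun i _ => ?_
    have h : algebraMap F ℍ[F, a, b] (star (q : ℍ[F, a, b]) * q).re = star (q : ℍ[F, a, b]) * q :=
      (QuaternionAlgebra.star_mul_eq_coe _).symm
    rw [map_mul, h, mul_assoc (star (x i)) _ (algebraMap F _ l), ← Algebra.commutes l]
    simp only [mul_assoc]

/-- `⟨s⟩ ⊥ ⟨t⟩ ≅ ⟨st(s+t)⟩ ⊥ ⟨s+t⟩`. -/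
theorem plane {s t : F} (hs : s + t ≠ 0) :
    HermIso F a b (Sum.elim (fun _ : Fin 1 => s) (fun _ : Fin 1 => t))
      (Sum.elim (fun _ : Fin 1 => s * t * (s + t)) (fun _ : Fin 1 => s + t)) := by
  let φ : ((Fin 1 ⊕ Fin 1 → ℍ[F, a, b]) ≃ₗ[F] (Fin 1 ⊕ Fin 1 → ℍ[F, a, b])) :=
    { toFun := fun x => Sum.elim (fun _ => x (.inr 0) + t • x (.inl 0))
        (fun _ => x (.inr 0) - s • x (.inl 0))
      invFun := fun x => Sum.elim (fun _ => (s + t)⁻¹ • (x (.inl 0) - x (.inr 0)))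
        (fun _ => (s + t)⁻¹ • (s • x (.inl 0) + t • x (.inr 0)))
      map_add' := fun x y => by ext1 (i | i) <;> simp <;> abel
      map_smul' := fun r x => by
        ext1 (i | i) <;> simp [smul_sub, smul_comm r]
      left_inv := fun x => by
        ext1 (i | i) <;> obtain rfl := Subsingleton.elim i 0 <;>
          simp only [Sum.elim_inl, Sum.elim_inr]
        · rw [inv_smul_eq_iff₀ hs]
          module
        · rw [inv_smul_eq_iff₀ hs]
          module
      right_inv := fun x => by
        ext1 (i | i) <;> obtain rfl := Subsingleton.elim i 0 <;>
          simp only [Sum.elim_inl, Sum.elim_inr] <;>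
          rw [smul_comm _ (s + t)⁻¹]
        · rw [← smul_add, inv_smul_eq_iff₀ hs]
          module
        · rw [← smul_sub, inv_smul_eq_iff₀ hs]
          module }
  refine symm ⟨φ, fun x d => ?_, fun x y => ?_⟩
  · ext1 (i | i) <;> simp [φ, add_mul, sub_mul]
  · simp only [hermD, φ, LinearEquiv.coe_mk, LinearMap.coe_mk, AddHom.coe_mk, Fintype.sum_sum_type,
      Finset.univ_unique, Finset.sum_singleton, Sum.elim_inl, Sum.elim_inr, Fin.default_eq_zero,
      star_add, star_sub, QuaternionAlgebra.star_smul, Algebra.algebraMap_eq_smul_one, mul_smul_comm,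
      smul_mul_assoc, mul_one, add_mul, mul_add, sub_mul, mul_sub, smul_add, smul_sub, smul_smul]
    module

end HermIso

section TraceForm

variable {F : Type*} [Field F] {a b : F} {ι κ : Type}

/-- The diagonal coefficients of the trace form of `⟨c i⟩ᵢ`. -/
def traceDiag (a b : F) (c : ι → F) : ι × Fin 4 → F :=
  fun p => c p.1 * ![1, -a, -b, a * b] p.2

theorem traceDiag_ne_zero (ha : a ≠ 0) (hb : b ≠ 0) {c : ι → F} (hc : ∀ i, c i ≠ 0)
    (p : ι × Fin 4) : traceDiag a b c p ≠ 0 := by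
  obtain ⟨i, j⟩ := p
  fin_cases j <;> simp [traceDiag, hc, ha, hb]

variable [Fintype ι] [Fintype κ]

theorem traceQ_eq_sum (c : ι → F) (x : ι → ℍ[F, a, b]) :
    traceQ F a b c x = ∑ i, c i * (star (x i) * x i).re := by
  let re : ℍ[F, a, b] →+ F := ⟨⟨QuaternionAlgebra.re, rfl⟩, fun _ _ => rfl⟩
  refine (map_sum re _ _).trans (Finset.sum_congr rfl fun i _ => ?_)
  rw [← Algebra.commutes, mul_assoc, ← Algebra.smul_def]
  rfl

theorem traceQ_equiv_diagQ (c : ι → F) :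
    QFunEquiv F (traceQ F a b c) (diagQ F (traceDiag a b c)) := by
  refine ⟨(LinearEquiv.piCongrRight fun _ : ι => QuaternionAlgebra.linearEquivTuple a 0 b).trans
    (LinearEquiv.curry F F ι (Fin 4)).symm, fun x => ?_⟩
  rw [traceQ_eq_sum, diagQ, Fintype.sum_prod_type]
  refine Finset.sum_congr rfl fun i _ => ?_
  simp [Fin.sum_univ_four, traceDiag, QuaternionAlgebra.equivTuple]
  ring

theorem HermIso.traceQ_equiv {c : ι → F} {d : κ → F} (h : HermIso F a b c d) :
    QFunEquiv F (traceQ F a b c) (traceQ F a b d) := by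
  obtain ⟨g, -, hg⟩ := h
  exact ⟨g, fun x => congrArg QuaternionAlgebra.re (hg x x)⟩

theorem HermIso.diagQ_traceDiag {c : ι → F} {d : κ → F} (h : HermIso F a b c d) :
    QFunEquiv F (diagQ F (traceDiag a b c)) (diagQ F (traceDiag a b d)) :=
  (traceQ_equiv_diagQ c).symm.trans (h.traceQ_equiv.trans (traceQ_equiv_diagQ d))

theorem diagQ_traceDiag_sumElim (c : ι → F) (d : κ → F) :
    QFunEquiv F (diagQ F (traceDiag a b (Sum.elim c d)))
      (diagQ F (Sum.elim (traceDiag a b c) (traceDiag a b d))) :=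
  diagQ_reindex (Equiv.sumProdDistrib ι κ (Fin 4)) (by rintro ⟨i | i, j⟩ <;> rfl)

theorem diagQ_traceDiag_hypDiag (h2 : (2 : F) ≠ 0) (ha : a ≠ 0) (hb : b ≠ 0) (k : ℕ) :
    QFunEquiv F (diagQ F (traceDiag a b (hypDiag F k))) (diagQ F (hypDiag F (k * 4))) := by
  let c : Fin k → F := fun _ => 1
  have h₀ : HermIso F a b (Sum.elim c (-c)) (hypDiag F k) := by
    refine HermIso.reindex ((Equiv.boolProdEquivSum (Fin k)).symm.trans ((Equiv.prodComm _ _).trans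
      ((Equiv.prodCongr (.refl _) finTwoEquiv.symm).trans
        (finProdFinEquiv.trans (finCongr (mul_comm k 2)))))) ?_
    rintro (i | i) <;> simp [hypDiag, finProdFinEquiv, finTwoEquiv, c]
  refine h₀.symm.diagQ_traceDiag.trans ((diagQ_traceDiag_sumElim c (-c)).trans ?_)
  have h₁ : traceDiag a b (-c) = -traceDiag a b c := by
    ext p
    simp [traceDiag]
  rw [h₁]
  exact diagQ_sumElim_neg_hypDiag h2 (traceDiag_ne_zero ha hb fun _ => one_ne_zero) (by simp)

/-- A diagonal hermitian form splits off every nonzero value of its trace form. -/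
theorem exists_hermIso_of_traceQ_eq (hdiv : ∀ x : ℍ[F, a, b], x ≠ 0 → IsUnit x) {n : ℕ}
    (c : Fin (n + 1) → F) (hc : ∀ i, c i ≠ 0) {t : F} (ht : t ≠ 0) (x : Fin (n + 1) → ℍ[F, a, b])
    (hx : traceQ F a b c x = t) :
    ∃ c' : Fin n → F, (∀ i, c' i ≠ 0) ∧ HermIso F a b c (Sum.elim c' fun _ : Fin 1 => t) := by
  induction n generalizing t with
  | zero =>
    rw [traceQ_eq_sum, Fin.sum_univ_one] at hx
    have hx0 : x 0 ≠ 0 := fun h => ht (by simp [← hx, h])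
    refine ⟨Fin.elim0, fun i => i.elim0, ?_⟩
    have h₁ := (HermIso.line_of_norm (c 0) (hdiv _ hx0)).symm
    rw [hx] at h₁
    exact (HermIso.reindex (d := fun _ : Fin 1 => c 0) (.refl _)
      fun i => congrArg c (Fin.fin_one_eq_zero i).symm).trans (h₁.trans
        (HermIso.reindex (Equiv.emptySum (Fin 0) (Fin 1)).symm fun _ => rfl))
  | succ n ih =>
    rw [traceQ_eq_sum, Fin.sum_univ_castSucc, ← traceQ_eq_sum (fun i => c (Fin.castSucc i))
      fun i => x i.castSucc] at hx
    set d := traceQ F a b (fun i => c (Fin.castSucc i)) fun i => x i.castSucc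
    set l := c (Fin.last (n + 1))
    set q := x (Fin.last (n + 1))
    have split : HermIso F a b c (Sum.elim (fun i => c (Fin.castSucc i)) fun _ : Fin 1 => l) :=
      (HermIso.reindex finSumFinEquiv (by
        rintro (i | i)
        · rfl
        · obtain rfl := Subsingleton.elim i 0; rfl)).symm
    have merge (c' : Fin n → F) (s : F) (hc' : ∀ i, c' i ≠ 0) (hs : s ≠ 0)
        (h : HermIso F a b c (Sum.elim c' (Sum.elim (fun _ : Fin 1 => s) fun _ : Fin 1 => t))) :
        ∃ c' : Fin (n + 1) → F, (∀ i, c' i ≠ 0) ∧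
          HermIso F a b c (Sum.elim c' fun _ : Fin 1 => t) := by
      refine ⟨Sum.elim c' (fun _ : Fin 1 => s) ∘ finSumFinEquiv.symm, fun i => ?_,
        h.trans ((HermIso.sumAssoc _ _ _).symm.trans
          ((HermIso.reindex finSumFinEquiv fun i => ?_).sumElim (.refl _)))⟩
      · rw [Function.comp_apply]
        rcases finSumFinEquiv.symm i with j | j
        · exact hc' j
        · exact hs
      · rw [Function.comp_apply, Equiv.symm_apply_apply]
    by_cases hd0 : d = 0
    · have hq0 : q ≠ 0 := fun h => ht (by simp [← hx, h, hd0])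
      have h₁ := (HermIso.line_of_norm l (hdiv _ hq0)).symm
      rw [show l * (star q * q).re = t by rw [← hx, hd0, zero_add]] at h₁
      exact ⟨_, fun i => hc i.castSucc, split.trans ((HermIso.refl _).sumElim h₁)⟩
    · obtain ⟨c', hc', h'⟩ := ih (fun i => c (Fin.castSucc i)) (fun i => hc _) hd0 _ rfl
      have h₁ := split.trans ((h'.sumElim (.refl _)).trans (HermIso.sumAssoc _ _ _))
      by_cases hq0 : q = 0
      · have hdt : d = t := by simpa [hq0] using hx
        rw [hdt] at h₁
        exact merge c' l hc' (hc _) (h₁.trans ((HermIso.refl _).sumElim (HermIso.sumComm _ _)))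
      · have h₂ := (HermIso.line_of_norm l (hdiv _ hq0)).symm
        set r := l * (star q * q).re
        have hr0 : r ≠ 0 := by
          refine mul_ne_zero (hc _) fun h0 => ?_
          have h₃ := QuaternionAlgebra.star_mul_eq_coe q
          rw [h0] at h₃
          have := ((hdiv q hq0).star.mul (hdiv q hq0)).ne_zero
          exact this (by simpa using h₃)
        have h₃ := HermIso.plane (a := a) (b := b) (s := d) (t := r) (by rwa [hx])
        rw [hx] at h₃
        exact merge c' _ hc' (mul_ne_zero (mul_ne_zero hd0 hr0) ht)
          (h₁.trans ((HermIso.refl _).sumElim (((HermIso.refl _).sumElim h₂).trans h₃)))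

/-- If the trace form of `⟨m j⟩ⱼ` is an orthogonal summand of the trace form of `⟨c i⟩ᵢ`, then
`⟨m j⟩ⱼ` is an orthogonal summand of `⟨c i⟩ᵢ`. -/
theorem exists_hermIso_sumElim (h2 : (2 : F) ≠ 0) (ha : a ≠ 0) (hb : b ≠ 0)
    (hdiv : ∀ x : ℍ[F, a, b], x ≠ 0 → IsUnit x) {k n : ℕ} (m : Fin k → F) (hm : ∀ i, m i ≠ 0)
    (c : Fin n → F) (hc : ∀ i, c i ≠ 0) (r : ι → F)
    (h : QFunEquiv F (diagQ F (traceDiag a b c)) (diagQ F (Sum.elim r (traceDiag a b m)))) :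
    ∃ (p : ℕ) (c' : Fin p → F), (∀ i, c' i ≠ 0) ∧ HermIso F a b c (Sum.elim c' m) ∧
      QFunEquiv F (diagQ F (traceDiag a b c')) (diagQ F r) := by
  induction k generalizing n with
  | zero =>
    refine ⟨n, c, hc, HermIso.reindex (Equiv.sumEmpty (Fin n) (Fin 0)).symm fun _ => rfl,
      h.trans (diagQ_reindex (Equiv.sumEmpty ι (Fin 0 × Fin 4)) fun i => ?_)⟩
    rcases i with i | i
    · rfl
    · exact i.1.elim0
  | succ k ih =>
    set m' : Fin k → F := fun i => m i.castSucc
    set t := m (Fin.last k)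
    have split : HermIso F a b m (Sum.elim m' fun _ : Fin 1 => t) :=
      (HermIso.reindex finSumFinEquiv (by
        rintro (i | i)
        · rfl
        · obtain rfl := Subsingleton.elim i 0; rfl)).symm
    have h₁ : QFunEquiv F (diagQ F (traceDiag a b c)) (diagQ F (Sum.elim
        (Sum.elim r (traceDiag a b m')) (traceDiag a b fun _ : Fin 1 => t))) :=
      h.trans ((diagQ_sumElim_congr (.refl _)
        (split.diagQ_traceDiag.trans (diagQ_traceDiag_sumElim _ _))).trans
          (diagQ_reindex (Equiv.sumAssoc _ _ _).symm (by rintro (i | i | i) <;> rfl)))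
    classical
    obtain ⟨g, hg⟩ := (traceQ_equiv_diagQ c).trans h₁
    have hx := hg (g.symm (Pi.single (.inr (0, 0)) 1))
    rw [g.apply_symm_apply] at hx
    have hval : diagQ F (Sum.elim (Sum.elim r (traceDiag a b m'))
        (traceDiag a b fun _ : Fin 1 => t)) (Pi.single (.inr (0, 0)) 1) = t := by
      rw [diagQ, Finset.sum_eq_single (.inr (0, 0))]
      · simp [traceDiag]
      · intro i _ hi
        simp [hi]
      · simp
    rw [hval] at hx
    rcases n with _ | n
    · exact absurd (hx.trans (by rw [traceQ_eq_sum, Fin.sum_univ_zero])) (hm _)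
    obtain ⟨c', hc', h'⟩ := exists_hermIso_of_traceQ_eq hdiv c hc (hm _) _ hx.symm
    have h₂ := QFunEquiv.diagQ_cancel h2 (traceDiag_ne_zero ha hb fun _ => hm _)
      ((h'.diagQ_traceDiag.trans (diagQ_traceDiag_sumElim _ _)).symm.trans h₁)
    obtain ⟨p, c'', hc'', h₃, h₄⟩ := ih m' (fun i => hm _) c' hc' h₂
    exact ⟨p, c'', hc'', h'.trans ((h₃.sumElim (.refl _)).trans ((HermIso.sumAssoc _ _ _).trans
      ((HermIso.refl _).sumElim split.symm))), h₄⟩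

end TraceForm

theorem ne_zero_of_forall_isUnit {L : Type*} [Field L] {a b : L}
    (hdiv : ∀ x : ℍ[L, a, b], x ≠ 0 → IsUnit x) : a ≠ 0 ∧ b ≠ 0 := by
  have key (x : ℍ[L, a, b]) (hx : x ≠ 0) : x * x ≠ 0 := ((hdiv x hx).mul (hdiv x hx)).ne_zero
  constructor
  · rintro rfl
    refine key ⟨0, 1, 0, 0⟩ (fun h => ?_) (by ext <;> simp)
    simpa using congrArg QuaternionAlgebra.imI h
  · rintro rfl
    refine key ⟨0, 0, 1, 0⟩ (fun h => ?_) (by ext <;> simp)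
    simpa using congrArg QuaternionAlgebra.imJ h

theorem wittEquivQ_traceQ_iff {F : Type*} [Field F] {a b : F} {n : ℕ} (c : Fin n → F) :
    WittEquivQ F (traceQ F a b c) (diagQ F (hypDiag F 0)) ↔
      ∃ k m : ℕ, QFunEquiv F (diagQ F (Sum.elim (traceDiag a b c) (hypDiag F k)))
        (diagQ F (hypDiag F m)) := by
  have h₁ (k : ℕ) : QFunEquiv F (qSum F (traceQ F a b c) (diagQ F (hypDiag F k)))
      (diagQ F (Sum.elim (traceDiag a b c) (hypDiag F k))) :=
    ((traceQ_equiv_diagQ c).qSum (.refl _)).trans (diagQ_sumElim _ _).symm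
  have h₂ (m : ℕ) : QFunEquiv F (qSum F (diagQ F (hypDiag F 0)) (diagQ F (hypDiag F m)))
      (diagQ F (hypDiag F m)) :=
    (diagQ_sumElim _ _).symm.trans (diagQ_reindex (Equiv.emptySum (Fin 0) (Fin (2 * m))) (by
      rintro (i | i)
      · exact i.elim0
      · rfl))
  exact exists₂_congr fun k m => ⟨fun h => (h₁ k).symm.trans (h.trans (h₂ m)),
    fun h => (h₁ k).trans (h.trans (h₂ m).symm)⟩

/-- A one-dimensional hermitian form over a division algebra has anisotropic trace form. -/
theorem not_diagQ_traceDiag_hypDiag_two {F : Type*} [Field F] {a b : F}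
    (hdiv : ∀ x : ℍ[F, a, b], x ≠ 0 → IsUnit x) (c : Fin 1 → F) (hc : ∀ i, c i ≠ 0) :
    ¬ QFunEquiv F (diagQ F (traceDiag a b c)) (diagQ F (hypDiag F 2)) := by
  intro h
  obtain ⟨g, hg⟩ := (traceQ_equiv_diagQ c).trans h
  have hx := hg (g.symm ![1, 1, 0, 0])
  have hval : diagQ F (hypDiag F 2) ![1, 1, 0, 0] = 0 := by
    refine (Fin.sum_univ_four _).trans ?_
    simp [hypDiag]
  rw [g.apply_symm_apply, hval, traceQ_eq_sum, Fin.sum_univ_one, eq_comm] at hx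
  set x := g.symm ![1, 1, 0, 0] with hxdef
  have hx0 : x 0 ≠ 0 := fun h0 => by
    have hz : x = 0 := by
      ext1 i
      rwa [Fin.fin_one_eq_zero i]
    rw [hxdef, g.symm_apply_eq, map_zero] at hz
    simpa using congrFun hz 0
  have h₃ := QuaternionAlgebra.star_mul_eq_coe (x 0)
  rw [(mul_eq_zero.mp hx).resolve_left (hc 0)] at h₃
  exact ((hdiv _ hx0).star.mul (hdiv _ hx0)).ne_zero (by simpa using h₃)

/-- A hermitian form with hyperbolic trace form is hyperbolic. -/
theorem exists_hermIso_hypDiag {F : Type*} [Field F] {a b : F} (h2 : (2 : F) ≠ 0)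
    (hdiv : ∀ x : ℍ[F, a, b], x ≠ 0 → IsUnit x) {n : ℕ} (c : Fin n → F) (hc : ∀ i, c i ≠ 0)
    (h : QFunEquiv F (diagQ F (traceDiag a b c)) (diagQ F (hypDiag F (2 * n)))) :
    ∃ p : ℕ, HermIso F a b c (hypDiag F p) := by
  obtain ⟨ha, hb⟩ := ne_zero_of_forall_isUnit hdiv
  obtain ⟨s, hs, p, hp⟩ : ∃ s < 2, ∃ p, 2 * n = 2 * s + p * 4 :=
    ⟨n % 2, Nat.mod_lt _ two_pos, n / 2, by omega⟩
  rw [hp] at h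
  obtain ⟨r, c', hc', h₁, h₂⟩ := exists_hermIso_sumElim h2 ha hb hdiv (hypDiag F p)
    (hypDiag_ne_zero p) c hc (hypDiag F (2 * s)) (h.trans ((diagQ_hypDiag_add _ _).symm.trans
      (diagQ_sumElim_congr (.refl _) (diagQ_traceDiag_hypDiag h2 ha hb p).symm)))
  have hcard := card_eq_of_diagQ h₂
  simp only [Fintype.card_prod, Fintype.card_fin] at hcard
  obtain rfl : r = s := by omega
  interval_cases r
  · exact ⟨p, h₁.trans (HermIso.reindex (Equiv.emptySum (Fin 0) (Fin (2 * p))) (by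
      rintro (i | i)
      · exact i.elim0
      · rfl))⟩
  · exact (not_diagQ_traceDiag_hypDiag_two hdiv c' hc' h₂).elim

/-- **The trace form embeds `W(D, τ₀)` into `W(L)` (Scharlau, 10.1.7).**
Let `D = ℍ[L, a, b]` be a quaternion division algebra over a field `L` of
characteristic `≠ 2`, with standard involution `τ₀ = star`.  The assignment
`h ↦ q_h` (trace form) induces an injective group homomorphism
`W(D, τ₀) → W(L)`, whose image is the principal ideal of `W(L)` generated by the
norm form `n_D` of `D`.  In particular, two hermitian forms over `(D, τ₀)` are
isomorphic if and only if their trace forms are isomorphic as quadratic forms.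
(Hermitian forms over `(D, τ₀)` are diagonalizable with coefficients in `L*`, and
are presented diagonally here; `n_D(x) = (x * star x).re`.) -/
theorem trace_form_injective_on_witt_group
    (L : Type*) [Field L] (hchar : (2 : L) ≠ 0) (a b : L)
    (hdiv : ∀ x : ℍ[L, a, b], x ≠ 0 → IsUnit x) :
    -- injectivity of `W(D, τ₀) → W(L)` :
    (∀ (n : ℕ) (lam : Fin n → L), (∀ i, lam i ≠ 0) →
      (WittEquivQ L (traceQ L a b lam) (diagQ L (hypDiag L 0)) ↔
        HermWittEquiv L a b lam (Fin.elim0 : Fin 0 → L))) ∧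
    -- the image is the principal ideal of `W(L)` generated by `n_D` :
    (∀ (m : ℕ) (c : Fin m → L), (∀ i, c i ≠ 0) →
      ((∃ (n : ℕ) (d : Fin n → L), (∀ i, d i ≠ 0) ∧
          WittEquivQ L (diagQ L c)
            (fun x : Fin n → ℍ[L, a, b] => ∑ i, d i * (x i * star (x i)).re)) ↔
        (∃ (n : ℕ) (lam : Fin n → L), (∀ i, lam i ≠ 0) ∧
          WittEquivQ L (diagQ L c) (traceQ L a b lam)))) ∧
    -- two hermitian forms are isomorphic iff their trace forms are isomorphic :
    (∀ (n : ℕ) (lam mu : Fin n → L), (∀ i, lam i ≠ 0) → (∀ i, mu i ≠ 0) →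
      (HermIso L a b lam mu ↔ QFunEquiv L (traceQ L a b lam) (traceQ L a b mu))) := by
  obtain ⟨ha, hb⟩ := ne_zero_of_forall_isUnit hdiv
  refine ⟨fun n lam hlam => ?_, fun m c hc => ?_, fun n lam mu hlam hmu => ?_⟩
  · rw [wittEquivQ_traceQ_iff]
    constructor
    · rintro ⟨k, m, h⟩
      have hcard := card_eq_of_diagQ h
      simp only [Fintype.card_sum, Fintype.card_prod, Fintype.card_fin] at hcard
      obtain rfl : m = 2 * n + k := by omega
      obtain ⟨p, hp⟩ := exists_hermIso_hypDiag hchar hdiv lam hlam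
        (QFunEquiv.diagQ_cancel hchar (hypDiag_ne_zero k) (h.trans (diagQ_hypDiag_add _ _).symm))
      exact ⟨0, p, (HermIso.reindex (Equiv.sumEmpty (Fin n) (Fin 0)) (by
        rintro (i | i)
        · rfl
        · exact i.elim0)).trans (hp.trans
          (HermIso.reindex (Equiv.emptySum (Fin 0) (Fin (2 * p))).symm fun _ => rfl))⟩
    · rintro ⟨k, m, h⟩
      have h' := h.trans (HermIso.reindex (d := hypDiag L m)
        (Equiv.emptySum (Fin 0) (Fin (2 * m))) (by
          rintro (i | i)
          · exact i.elim0
          · rfl))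
      exact ⟨k * 4, m * 4, (diagQ_sumElim_congr (.refl _)
        (diagQ_traceDiag_hypDiag hchar ha hb k).symm).trans ((diagQ_traceDiag_sumElim _ _).symm.trans
          (h'.diagQ_traceDiag.trans (diagQ_traceDiag_hypDiag hchar ha hb m)))⟩
  · have key (n : ℕ) (d : Fin n → L) :
        (fun x : Fin n → ℍ[L, a, b] => ∑ i, d i * (x i * star (x i)).re) = traceQ L a b d := by
      ext x
      simp only [traceQ_eq_sum, star_comm_self']
    simp only [key]
  · refine ⟨HermIso.traceQ_equiv, fun h => ?_⟩
    have h₁ := (traceQ_equiv_diagQ lam).symm.trans (h.trans (traceQ_equiv_diagQ mu))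
    obtain ⟨p, c', -, h₂, h₃⟩ := exists_hermIso_sumElim hchar ha hb hdiv mu hmu lam hlam
      (Fin.elim0 : Fin 0 → L) (h₁.trans
        (diagQ_reindex (Equiv.emptySum (Fin 0) (Fin n × Fin 4)).symm fun _ => rfl))
    have hcard := card_eq_of_diagQ h₃
    simp only [Fintype.card_prod, Fintype.card_fin] at hcard
    obtain rfl : p = 0 := by omega
    exact h₂.trans (HermIso.reindex (Equiv.emptySum (Fin 0) (Fin n)) (by
      rintro (i | i)
      · exact i.elim0
      · rfl))
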